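/- arXiv:1401.6150 — 7 statements merged into one kernel-verified Lean document; each statement's English description precedes it below -/
import Mathlib

section
/- Let h, i, j, q be positive integers with gcd(h,i,j) = 1 such that q divides h·(i²+j²) and q divides i·(h²+j²). Then there exist pairwise coprime positive integers w₁, w₂, w₃, w₄ with q = w₁w₂w₃w₄ such that: w₁ ∣ h, w₁ ∣ i, gcd(w₁, i²+j²) = 1, gcd(w₁, h²+j²) = 1; w₂ ∣ h, w₂ ∣ h²+j², gcd(w₂, i) = 1, gcd(w₂, i²+j²) = 1; w₃ ∣ i, w₃ ∣ i²+j², gcd(w₃, h) = 1, gcd(w₃, h²+j²) = 1; and w₄ ∣ i²+j², w₄ ∣ h²+j², gcd(w₄, h) = 1, gcd(w₄, i) = 1. -/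
theorem Nat.gcd_mul_gcd_eq_of_dvd_mul {q a b : ℕ} (hab : Nat.Coprime (q.gcd a) b)
    (h : q ∣ a * b) : q.gcd a * q.gcd b = q := by
  apply Nat.dvd_antisymm
  · exact (hab.coprime_dvd_right (Nat.gcd_dvd_right q b)).mul_dvd_of_dvd_of_dvd
      (Nat.gcd_dvd_left q a) (Nat.gcd_dvd_left q b)
  · have hdvd : q ∣ q.gcd a * b := by
      rw [← Nat.gcd_mul_right]
      exact Nat.dvd_gcd (Dvd.intro b rfl) h
    rw [← Nat.gcd_mul_left]
    exact Nat.dvd_gcd (Dvd.intro_left _ rfl) hdvd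

theorem Nat.coprime_gcd_sq_add_sq {h i j q : ℕ} (hgcd : Nat.gcd (Nat.gcd h i) j = 1)
    (hq : q ∣ i * (h ^ 2 + j ^ 2)) : Nat.Coprime (q.gcd h) (i ^ 2 + j ^ 2) := by
  refine Nat.coprime_of_dvd fun p hp hpqh hpA => hp.one_lt.ne' ?_
  have hph : p ∣ h := hpqh.trans (Nat.gcd_dvd_right q h)
  have hpij : p ∣ i ∧ p ∣ j := by
    rcases hp.dvd_mul.1 ((hpqh.trans (Nat.gcd_dvd_left q h)).trans hq) with hpi | hpB
    · exact ⟨hpi, hp.dvd_of_dvd_pow ((Nat.dvd_add_right (dvd_pow hpi two_ne_zero)).1 hpA)⟩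
    · have hpj : p ∣ j :=
        hp.dvd_of_dvd_pow ((Nat.dvd_add_right (dvd_pow hph two_ne_zero)).1 hpB)
      exact ⟨hp.dvd_of_dvd_pow ((Nat.dvd_add_left (dvd_pow hpj two_ne_zero)).1 hpA), hpj⟩
  exact Nat.dvd_one.1 (hgcd ▸ Nat.dvd_gcd (Nat.dvd_gcd hph hpij.1) hpij.2)

theorem stmt_0 (h i j q : ℕ) (hh : 0 < h) (hi : 0 < i) (hj : 0 < j) (hq : 0 < q)
    (hgcd : Nat.gcd (Nat.gcd h i) j = 1)
    (hqa : q ∣ h * (i ^ 2 + j ^ 2)) (hqb : q ∣ i * (h ^ 2 + j ^ 2)) :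
    ∃ w₁ w₂ w₃ w₄ : ℕ, 0 < w₁ ∧ 0 < w₂ ∧ 0 < w₃ ∧ 0 < w₄ ∧
      Nat.Coprime w₁ w₂ ∧ Nat.Coprime w₁ w₃ ∧ Nat.Coprime w₁ w₄ ∧
      Nat.Coprime w₂ w₃ ∧ Nat.Coprime w₂ w₄ ∧ Nat.Coprime w₃ w₄ ∧
      q = w₁ * w₂ * w₃ * w₄ ∧
      w₁ ∣ h ∧ w₁ ∣ i ∧ Nat.gcd w₁ (i ^ 2 + j ^ 2) = 1 ∧ Nat.gcd w₁ (h ^ 2 + j ^ 2) = 1 ∧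
      w₂ ∣ h ∧ w₂ ∣ h ^ 2 + j ^ 2 ∧ Nat.gcd w₂ i = 1 ∧ Nat.gcd w₂ (i ^ 2 + j ^ 2) = 1 ∧
      w₃ ∣ i ∧ w₃ ∣ i ^ 2 + j ^ 2 ∧ Nat.gcd w₃ h = 1 ∧ Nat.gcd w₃ (h ^ 2 + j ^ 2) = 1 ∧
      w₄ ∣ i ^ 2 + j ^ 2 ∧ w₄ ∣ h ^ 2 + j ^ 2 ∧ Nat.gcd w₄ h = 1 ∧ Nat.gcd w₄ i = 1 := by
  have hhA : Nat.Coprime (q.gcd h) (i ^ 2 + j ^ 2) := Nat.coprime_gcd_sq_add_sq hgcd hqb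
  have hiB : Nat.Coprime (q.gcd i) (h ^ 2 + j ^ 2) :=
    Nat.coprime_gcd_sq_add_sq (Nat.gcd_comm h i ▸ hgcd) hqa
  generalize i ^ 2 + j ^ 2 = A at *
  generalize h ^ 2 + j ^ 2 = B at *
  have hAh : Nat.Coprime (q.gcd A) h := by
    rwa [Nat.Coprime, Nat.gcd_right_comm]
  have hBi : Nat.Coprime (q.gcd B) i := by
    rwa [Nat.Coprime, Nat.gcd_right_comm]
  have gcd_dvd {a b : ℕ} : (q.gcd a).gcd b ∣ q.gcd b :=
    Nat.gcd_dvd_gcd_of_dvd_left b (Nat.gcd_dvd_left q a)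
  have dvd_left {a b : ℕ} : (q.gcd a).gcd b ∣ a :=
    (Nat.gcd_dvd_left _ b).trans (Nat.gcd_dvd_right q a)
  have dvd_right {a b : ℕ} : (q.gcd a).gcd b ∣ b := Nat.gcd_dvd_right _ b
  have pos {a b : ℕ} : 0 < (q.gcd a).gcd b :=
    Nat.gcd_pos_of_pos_left b (Nat.gcd_pos_of_pos_left a hq)
  have coprime_of_left {a b c : ℕ} (hac : Nat.Coprime (q.gcd a) c) :
      Nat.Coprime ((q.gcd a).gcd b) c := hac.coprime_dvd_left (Nat.gcd_dvd_left _ b)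
  have coprime_of_right {a b c : ℕ} (hbc : Nat.Coprime (q.gcd b) c) :
      Nat.Coprime ((q.gcd a).gcd b) c := hbc.coprime_dvd_left gcd_dvd
  have split {a : ℕ} : ((q.gcd a).gcd i) * ((q.gcd a).gcd B) = q.gcd a :=
    Nat.gcd_mul_gcd_eq_of_dvd_mul (hiB.coprime_dvd_left gcd_dvd)
      ((Nat.gcd_dvd_left q a).trans hqb)
  refine ⟨(q.gcd h).gcd i, (q.gcd h).gcd B, (q.gcd A).gcd i, (q.gcd A).gcd B,
    pos, pos, pos, pos,
    (coprime_of_right hiB).coprime_dvd_right dvd_right,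
    (coprime_of_left hhA).coprime_dvd_right dvd_left,
    (coprime_of_left hhA).coprime_dvd_right dvd_left,
    (coprime_of_left hhA).coprime_dvd_right dvd_left,
    (coprime_of_left hhA).coprime_dvd_right dvd_left,
    (coprime_of_right hiB).coprime_dvd_right dvd_right, ?_,
    dvd_left, dvd_right, coprime_of_left hhA, coprime_of_right hiB,
    dvd_left, dvd_right, coprime_of_right hBi, coprime_of_left hhA,
    dvd_right, dvd_left, coprime_of_left hAh, coprime_of_right hiB,
    dvd_left, dvd_right, coprime_of_left hAh, coprime_of_right hBi⟩
  rw [mul_assoc _ ((q.gcd A).gcd i), split, split, Nat.gcd_mul_gcd_eq_of_dvd_mul hhA hqa]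
end

section
/- Let h, i, j, q be positive integers with gcd(h,i,j) = 1 such that q divides h·(i²+j²) and q divides i·(h²+j²). Then there exist positive integers q₁, q₂ with q = q₁·q₂, gcd(q₁,q₂) = 1, q₁ ∣ h and q₂ ∣ i²+j². -/
/-- If `q` divides `m * n` and `q` has coprime common parts with `m` and `n`, then `q` is the
product of these parts. -/
theorem Nat.eq_gcd_mul_gcd_of_dvd_mul {q m n : ℕ} (hd : q ∣ m * n)
    (hc : Nat.Coprime (q.gcd m) (q.gcd n)) : q = q.gcd m * q.gcd n := by
  refine Nat.dvd_antisymm ?_ (hc.mul_dvd_of_dvd_of_dvd (q.gcd_dvd_left m) (q.gcd_dvd_left n))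
  have := Nat.gcd_mul_right_dvd_mul_gcd q m n
  rwa [Nat.gcd_eq_left hd] at this

theorem Nat.Prime.dvd_and_dvd_of_dvd_sq_add_sq {p a b : ℕ} (hp : p.Prime)
    (hs : p ∣ a ^ 2 + b ^ 2) (hab : p ∣ a ∨ p ∣ b) : p ∣ a ∧ p ∣ b := by
  rcases hab with ha | hb
  · exact ⟨ha, hp.dvd_of_dvd_pow ((Nat.dvd_add_right (dvd_pow ha two_ne_zero)).1 hs)⟩
  · exact ⟨hp.dvd_of_dvd_pow ((Nat.dvd_add_left (dvd_pow hb two_ne_zero)).1 hs), hb⟩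

theorem stmt_1 (h i j q : ℕ) (hh : 0 < h) (hi : 0 < i) (hj : 0 < j) (hq : 0 < q)
    (hgcd : Nat.gcd (Nat.gcd h i) j = 1)
    (hqa : q ∣ h * (i ^ 2 + j ^ 2)) (hqb : q ∣ i * (h ^ 2 + j ^ 2)) :
    ∃ q₁ q₂ : ℕ, 0 < q₁ ∧ 0 < q₂ ∧ q = q₁ * q₂ ∧ Nat.gcd q₁ q₂ = 1 ∧
      q₁ ∣ h ∧ q₂ ∣ i ^ 2 + j ^ 2 := by
  have hc : Nat.Coprime (q.gcd h) (q.gcd (i ^ 2 + j ^ 2)) := by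
    refine Nat.Coprime.symm (Nat.coprime_of_dvd fun p hp h₂ h₁ => ?_)
    have hpq : p ∣ q := h₁.trans (q.gcd_dvd_left h)
    have hph : p ∣ h := h₁.trans (q.gcd_dvd_right h)
    have hij : p ∣ i ∨ p ∣ j := (hp.dvd_mul.1 (hpq.trans hqb)).imp_right fun hs =>
      hp.dvd_of_dvd_pow ((Nat.dvd_add_right (dvd_pow hph two_ne_zero)).1 hs)
    obtain ⟨hpi, hpj⟩ := hp.dvd_and_dvd_of_dvd_sq_add_sq (h₂.trans (q.gcd_dvd_right _)) hij
    exact hp.one_lt.ne' (Nat.dvd_one.1 (hgcd ▸ Nat.dvd_gcd (Nat.dvd_gcd hph hpi) hpj))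
  exact ⟨q.gcd h, q.gcd (i ^ 2 + j ^ 2), Nat.gcd_pos_of_pos_left _ hq,
    Nat.gcd_pos_of_pos_left _ hq, Nat.eq_gcd_mul_gcd_of_dvd_mul hqa hc, hc,
    q.gcd_dvd_right h, q.gcd_dvd_right _⟩
end

section
/- Let h, i, j, d be positive integers with gcd(h,i,j) = 1, i·h > j², such that d divides i²+j², d divides h²+j², d divides (i+h)·(ih−j²), gcd(d,h) = 1 and gcd(d,i) = 1. Then d divides 2·(i+h). -/
theorem stmt_2 (h i j d : ℕ) (hh : 0 < h) (hi : 0 < i) (hj : 0 < j) (hd : 0 < d)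
    (hgcd : Nat.gcd (Nat.gcd h i) j = 1) (hij : j ^ 2 < i * h)
    (hd1 : d ∣ i ^ 2 + j ^ 2) (hd2 : d ∣ h ^ 2 + j ^ 2)
    (hd3 : d ∣ (i + h) * (i * h - j ^ 2))
    (hdh : Nat.gcd d h = 1) (hdi : Nat.gcd d i = 1) :
    d ∣ 2 * (i + h) := by
  zify [hij.le] at hd1 hd2 hd3 ⊢
  have hcop : IsCoprime (d : ℤ) i := Nat.isCoprime_iff_coprime.mpr hdi
  refine hcop.dvd_of_dvd_mul_left (hcop.dvd_of_dvd_mul_left ?_)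
  have key : (i : ℤ) * (i * (2 * (i + h))) =
      (i + h) * (i * h - j ^ 2) + (i + h) * (i ^ 2 + j ^ 2) +
        i * ((i ^ 2 + j ^ 2) - (h ^ 2 + j ^ 2)) := by ring
  rw [key]
  exact ((hd3.add (hd1.mul_left _)).add ((hd1.sub hd2).mul_left _))
end

section
/- Let h, i, j, d be positive integers with gcd(h,i,j) = 1, i·h > j², such that d divides i²+j², d divides h²+j², d divides (i+h)·(ih−j²), gcd(d,h) = 1 and gcd(d,i) = 1. Then d² divides 8·(i+h)·(ih−j²). -/
/-- If `d` is coprime to `a` and `b` and divides `a ^ 2 + c ^ 2`, `b ^ 2 + c ^ 2` and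
`(a + b) * (a * b - c ^ 2)`, then `d` divides `2 * (a + b)`. -/
theorem dvd_two_mul_add_of_isCoprime {R : Type*} [CommRing R] {a b c d : R}
    (ha : d ∣ a ^ 2 + c ^ 2) (hb : d ∣ b ^ 2 + c ^ 2)
    (hab : d ∣ (a + b) * (a * b - c ^ 2))
    (hdb : IsCoprime d b) (hda : IsCoprime d a) : d ∣ 2 * (a + b) := by
  have h_sq : d ∣ (a + b) ^ 2 := by
    refine hda.dvd_of_dvd_mul_left ?_
    convert hab.add (ha.mul_left (a + b)) using 1
    ring
  refine hdb.dvd_of_dvd_mul_left ?_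
  convert (h_sq.sub ha).add hb using 1
  ring

theorem sq_dvd_eight_mul_add_mul_sub_sq {R : Type*} [CommRing R] {a b c d : R}
    (ha : d ∣ a ^ 2 + c ^ 2) (hb : d ∣ b ^ 2 + c ^ 2) (hab : d ∣ 2 * (a + b)) :
    d ^ 2 ∣ 8 * (a + b) * (a * b - c ^ 2) := by
  have h_sub : d ∣ 4 * (a * b - c ^ 2) := by
    convert ((hab.mul_right (a + b)).sub (ha.mul_left 2)).sub (hb.mul_left 2) using 1
    ring
  convert mul_dvd_mul hab h_sub using 1 <;> ring

theorem stmt_3 (h i j d : ℕ) (hh : 0 < h) (hi : 0 < i) (hj : 0 < j) (hd : 0 < d)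
    (hgcd : Nat.gcd (Nat.gcd h i) j = 1) (hij : j ^ 2 < i * h)
    (hd1 : d ∣ i ^ 2 + j ^ 2) (hd2 : d ∣ h ^ 2 + j ^ 2)
    (hd3 : d ∣ (i + h) * (i * h - j ^ 2))
    (hdh : Nat.gcd d h = 1) (hdi : Nat.gcd d i = 1) :
    d ^ 2 ∣ 8 * (i + h) * (i * h - j ^ 2) := by
  zify [hij.le] at hd1 hd2 hd3 ⊢
  exact sq_dvd_eight_mul_add_mul_sub_sq hd1 hd2 <|
    dvd_two_mul_add_of_isCoprime hd1 hd2 hd3 (Nat.isCoprime_iff_coprime.mpr hdh)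
      (Nat.isCoprime_iff_coprime.mpr hdi)
end

section
/- Let h, i, j, d be positive integers with gcd(h,i,j) = 1, i·h > j², such that d divides i²+j², d divides h²+j², d divides (i+h)·(ih−j²), gcd(d,h) = 1 and gcd(d,i) = 1. If m is a positive integer with (i+h)·(ih−j²) = d·m, then d divides 8·m; in particular d ≤ 8·m. -/
theorem stmt_4 (h i j d : ℕ) (hh : 0 < h) (hi : 0 < i) (hj : 0 < j) (hd : 0 < d)
    (hgcd : Nat.gcd (Nat.gcd h i) j = 1) (hij : j ^ 2 < i * h)
    (hd1 : d ∣ i ^ 2 + j ^ 2) (hd2 : d ∣ h ^ 2 + j ^ 2)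
    (hd3 : d ∣ (i + h) * (i * h - j ^ 2))
    (hdh : Nat.gcd d h = 1) (hdi : Nat.gcd d i = 1)
    (m : ℕ) (hm : 0 < m) (hdm : (i + h) * (i * h - j ^ 2) = d * m) :
    d ∣ 8 * m ∧ d ≤ 8 * m := by
  obtain ⟨q, hq⟩ : ∃ q, i * h = j ^ 2 + q := ⟨i * h - j ^ 2, by omega⟩
  have hsub : i * h - j ^ 2 = q := by omega
  rw [hsub] at hd3 hdm
  have hcop : Nat.Coprime d i := hdi
  have hiS : i * (i + h) = (i ^ 2 + j ^ 2) + q := by linarith [hq, sq i]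
  have hS2 : d ∣ (i + h) * (i + h) := by
    refine hcop.dvd_of_dvd_mul_left ?_
    have e : i * ((i + h) * (i + h)) = (i ^ 2 + j ^ 2) * (i + h) + (i + h) * q := by
      linear_combination (i + h) * hiS
    exact e ▸ dvd_add (hd1.mul_right _) hd3
  have hS : d ∣ 2 * (i + h) := by
    refine hcop.dvd_of_dvd_mul_left ((Nat.dvd_add_left hd2).mp ?_)
    have e : i * (2 * (i + h)) + (h ^ 2 + j ^ 2) = (i + h) * (i + h) + (i ^ 2 + j ^ 2) := by
      ring
    exact e ▸ dvd_add hS2 hd1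
  have hQ : d ∣ 2 * q := by
    refine (Nat.dvd_add_right (hd1.mul_left 2)).mp ?_
    have e : 2 * (i ^ 2 + j ^ 2) + 2 * q = i * (2 * (i + h)) := by linarith
    exact e ▸ hS.mul_left i
  have hdvd : d ∣ 4 * m := by
    refine Nat.dvd_of_mul_dvd_mul_left hd ?_
    have e : d * (4 * m) = 2 * (i + h) * (2 * q) := by linarith
    exact e ▸ mul_dvd_mul hS hQ
  have hdvd8 : d ∣ 8 * m := hdvd.trans ⟨2, by ring⟩
  exact ⟨hdvd8, Nat.le_of_dvd (by positivity) hdvd8⟩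
end

section
/- Let h, i, j be positive integers with i·h > j², and set a = h·(i²+j²), b = i·(h²+j²), c = (i+h)·(ih−j²). Then a, b, c are positive integers satisfying the strict triangle inequalities a < b + c, b < a + c, c < a + b, and the triangle with side lengths a, b, c has integer area equal to h·i·j·(i+h)·(ih−j²); in particular (a,b,c) is an integer Heronian triangle. -/
theorem stmt_9 (h i j : ℤ) (hh : 0 < h) (hi : 0 < i) (hj : 0 < j)
    (hij : j ^ 2 < i * h)
    (a b c : ℤ)
    (ha : a = h * (i ^ 2 + j ^ 2)) (hb : b = i * (h ^ 2 + j ^ 2))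
    (hc : c = (i + h) * (i * h - j ^ 2)) :
    0 < a ∧ 0 < b ∧ 0 < c ∧
    a < b + c ∧ b < a + c ∧ c < a + b ∧
    0 < h * i * j * (i + h) * (i * h - j ^ 2) ∧
    16 * (h * i * j * (i + h) * (i * h - j ^ 2)) ^ 2 =
      (a + b + c) * (a + b - c) * (a - b + c) * (-a + b + c) := by
  have hd : 0 < i * h - j ^ 2 := sub_pos.mpr hij
  have habc : a + b - c = 2 * (j ^ 2 * (i + h)) := by rw [ha, hb, hc]; ring
  have hacb : a - b + c = 2 * (i * (i * h - j ^ 2)) := by rw [ha, hb, hc]; ring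
  have hbca : -a + b + c = 2 * (h * (i * h - j ^ 2)) := by rw [ha, hb, hc]; ring
  have hj_pos : 0 < j ^ 2 * (i + h) := by positivity
  have hi_pos : 0 < i * (i * h - j ^ 2) := mul_pos hi hd
  have hh_pos : 0 < h * (i * h - j ^ 2) := mul_pos hh hd
  refine ⟨by rw [ha]; positivity, by rw [hb]; positivity, by rw [hc]; positivity,
    by linarith, by linarith, by linarith, by positivity, ?_⟩
  rw [habc, hacb, hbca, ha, hb, hc]
  ring
end

section
/- Let a, b, c be positive integers satisfying the strict triangle inequalities a < b + c, b < a + c, c < a + b, and suppose r is a nonnegative rational number with 16·r² = (a+b+c)·(a+b−c)·(a−b+c)·(−a+b+c). Then r is an integer. -/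
theorem Rat.exists_eq_intCast_of_sq_eq_intCast {r : ℚ} {n : ℤ} (h : r ^ 2 = n) :
    ∃ k : ℤ, r = k := by
  have hint : IsIntegral ℤ (r ^ 2) := by
    rw [h]
    exact isIntegral_algebraMap (R := ℤ) (A := ℚ) (x := n)
  obtain ⟨k, hk⟩ := IsIntegrallyClosed.isIntegral_iff.mp (hint.of_pow two_pos)
  exact ⟨k, hk.symm⟩

theorem Int.sq_ne_heron_of_odd {a b c : ℤ} (h : Odd (a + b + c)) (s : ℤ) :
    s ^ 2 ≠ (a + b + c) * (a + b - c) * (a - b + c) * (-a + b + c) := by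
  intro hs
  obtain ⟨p, hp⟩ := h
  obtain rfl : c = 2 * p + 1 - a - b := by linarith
  rcases Int.even_or_odd' s with ⟨t, rfl | rfl⟩ <;> ring_nf at hs <;> omega

theorem stmt_14 (a b c : ℕ) (ha : 0 < a) (hb : 0 < b) (hc : 0 < c)
    (h₁ : a < b + c) (h₂ : b < a + c) (h₃ : c < a + b)
    (r : ℚ) (hr : 0 ≤ r)
    (heron : 16 * r ^ 2 =
      ((a : ℚ) + b + c) * ((a : ℚ) + b - c) * ((a : ℚ) - b + c) * (-(a : ℚ) + b + c)) :
    ∃ k : ℤ, r = k := by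
  rcases Int.even_or_odd ((a : ℤ) + b + c) with ⟨p, hp⟩ | hodd
  · have hp' : (a : ℚ) + b + c = p + p := by exact_mod_cast hp
    have hc' : (c : ℚ) = 2 * p - a - b := by linarith
    refine Rat.exists_eq_intCast_of_sq_eq_intCast (n := p * (p - a) * (p - b) * (p - c)) ?_
    push_cast
    rw [hc'] at heron ⊢
    linear_combination heron / 16
  · obtain ⟨s, hs⟩ := Rat.exists_eq_intCast_of_sq_eq_intCast (r := 4 * r)
      (n := ((a : ℤ) + b + c) * (a + b - c) * (a - b + c) * (-a + b + c)) (by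
        push_cast
        linear_combination heron)
    refine absurd ?_ (Int.sq_ne_heron_of_odd hodd s)
    have hsq : (s : ℚ) ^ 2 =
        ((a : ℚ) + b + c) * (a + b - c) * (a - b + c) * (-a + b + c) := by
      rw [← hs]
      linear_combination heron
    exact_mod_cast hsq
end
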